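/- arXiv:2108.04071 — 5 statements merged into one kernel-verified Lean document; each statement's English description precedes it below -/
import Mathlib

section
/- Let ε > 0, let I be an instance of the scheduling problem with a non-renewable resource, and let I' be its rounded instance. Then every schedule (σ, t) that is feasible for the rounded instance I' is also feasible for the original instance I; moreover, for every machine i, the load of machine i under (σ, t) with respect to I is at most the load of machine i under (σ, t) with respect to I'. Consequently, the makespan and the norm-cost of (σ, t) with respect to I are at most the makespan and the norm-cost of (σ, t) with respect to I'. -/
open Finset

/-- An instance of the scheduling problem with a non-renewable resource:
`m` machines with speeds `s`, `n` jobs with sizes `p` and resource requirements `d`,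
and `e` replenishment dates `u` with supplied quantities `q`. -/
structure SchedInstance (m n e : ℕ) where
  s : Fin m → ℝ
  p : Fin n → ℝ
  d : Fin n → ℝ
  u : Fin e → ℝ
  q : Fin e → ℝ

/-- Validity of an instance: speeds in (0,1] with fastest speed 1, positive job sizes,
nonnegative resource requirements, nondecreasing nonnegative replenishment dates,
nonnegative supplied quantities. -/
def SchedInstance.Valid {m n e : ℕ} (I : SchedInstance m n e) : Prop :=
  (∀ i, 0 < I.s i ∧ I.s i ≤ 1) ∧ (∃ i, I.s i = 1) ∧ (∀ j, 0 < I.p j) ∧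
    (∀ j, 0 ≤ I.d j) ∧ (∀ k, 0 ≤ I.u k) ∧ Monotone I.u ∧ (∀ k, 0 ≤ I.q k)

/-- Feasibility of a schedule `(σ, t)`: nonnegative start times, no overlap of jobs sharing
a machine, and for every time `τ`, the resource consumed by jobs started before `τ` is at
most the resource supplied strictly before `τ`. -/
def Feasible {m n e : ℕ} (I : SchedInstance m n e) (σ : Fin n → Fin m) (t : Fin n → ℝ) :
    Prop :=
  (∀ j, 0 ≤ t j) ∧
  (∀ j j' : Fin n, j ≠ j' → σ j = σ j' →
      t j + I.p j / I.s (σ j) ≤ t j' ∨ t j' + I.p j' / I.s (σ j') ≤ t j) ∧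
  (∀ τ : ℝ, ∑ j ∈ univ.filter (fun j => t j < τ), I.d j
      ≤ ∑ k ∈ univ.filter (fun k => I.u k < τ), I.q k)

/-- The load of machine `i`: the maximum completion time of a job assigned to `i`
(`0` if no job is assigned to `i`). -/
noncomputable def load {m n e : ℕ} (I : SchedInstance m n e) (σ : Fin n → Fin m)
    (t : Fin n → ℝ) (i : Fin m) : ℝ :=
  (univ.filter (fun j => σ j = i)).fold max 0 (fun j => t j + I.p j / I.s i)

/-- The makespan: the maximum load over all machines. -/
noncomputable def makespan {m n e : ℕ} (I : SchedInstance m n e) (σ : Fin n → Fin m)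
    (t : Fin n → ℝ) : ℝ :=
  univ.fold max 0 (load I σ t)

/-- The norm-cost: the sum over machines of the `φ`-th power of the load. -/
noncomputable def normCost {m n e : ℕ} (I : SchedInstance m n e) (φ : ℝ)
    (σ : Fin n → Fin m) (t : Fin n → ℝ) : ℝ :=
  ∑ i, load I σ t i ^ φ

/-- The objective: the convex combination of makespan and norm-cost with coefficient `ψ`. -/
noncomputable def obj {m n e : ℕ} (I : SchedInstance m n e) (φ ψ : ℝ)
    (σ : Fin n → Fin m) (t : Fin n → ℝ) : ℝ :=
  ψ * makespan I σ t + (1 - ψ) * normCost I φ σ t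

/-- The minimum job size. -/
noncomputable def pmin {m n e : ℕ} (I : SchedInstance m n e) : ℝ := ⨅ j, I.p j

/-- The rounded instance: job sizes rounded up to powers of `1+ε`, speeds rounded down to
powers of `1+ε`, and replenishment dates shifted by `ε · pmin` and rounded up to powers
of `1+ε`. -/
noncomputable def rounded {m n e : ℕ} (ε : ℝ) (I : SchedInstance m n e) :
    SchedInstance m n e where
  s := fun i => (1 + ε) ^ ⌊Real.logb (1 + ε) (I.s i)⌋
  p := fun j => (1 + ε) ^ ⌈Real.logb (1 + ε) (I.p j)⌉
  d := I.d
  u := fun k => (1 + ε) ^ ⌈Real.logb (1 + ε) (I.u k + ε * pmin I)⌉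
  q := I.q

theorem le_round_up (b x : ℝ) (hb : 1 < b) (hx : 0 < x) : x ≤ b ^ ⌈Real.logb b x⌉ := by
  have h := Int.le_ceil (Real.logb b x)
  rw [Real.logb_le_iff_le_rpow hb hx, Real.rpow_intCast] at h
  exact h

theorem round_down_le (b x : ℝ) (hb : 1 < b) (hx : 0 < x) : b ^ ⌊Real.logb b x⌋ ≤ x := by
  have h := Int.floor_le (Real.logb b x)
  rw [Real.le_logb_iff_rpow_le hb hx, Real.rpow_intCast] at h
  exact h

theorem fold_max_mono {ι : Type*} (S : Finset ι) (f g : ι → ℝ) (h : ∀ i ∈ S, f i ≤ g i) :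
    S.fold max 0 f ≤ S.fold max 0 g := by
  rw [Finset.fold_max_le]
  refine ⟨?_, fun i hi => ?_⟩
  · rw [Finset.le_fold_max]
    exact Or.inl le_rfl
  · rw [Finset.le_fold_max]
    exact Or.inr ⟨i, hi, h i hi⟩

/-- Every schedule feasible for the rounded instance `I'` is feasible for the
original instance `I`; the load of every machine with respect to `I` is at most its load
with respect to `I'`; consequently the makespan and norm-cost with respect to `I` are at
most those with respect to `I'`. -/
theorem feasible_of_rounded_feasible {m n e : ℕ} (ε : ℝ) (hε : 0 < ε) (hn : 0 < n)
    (I : SchedInstance m n e) (hI : I.Valid) (φ : ℝ) (hφ : 1 < φ)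
    (σ : Fin n → Fin m) (t : Fin n → ℝ)
    (hfeas : Feasible (rounded ε I) σ t) :
    Feasible I σ t ∧
      (∀ i, load I σ t i ≤ load (rounded ε I) σ t i) ∧
      makespan I σ t ≤ makespan (rounded ε I) σ t ∧
      normCost I φ σ t ≤ normCost (rounded ε I) φ σ t := by
  obtain ⟨hs, -, hp, -, hu, -, hq⟩ := hI
  have hb : 1 < 1 + ε := by linarith
  have : Nonempty (Fin n) := ⟨⟨0, hn⟩⟩
  have hpm : 0 < pmin I := by
    obtain ⟨j, hj⟩ := exists_eq_ciInf_of_finite (f := I.p)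
    unfold pmin
    rw [← hj]
    exact hp j
  have hproc : ∀ j i, I.p j / I.s i ≤ (rounded ε I).p j / (rounded ε I).s i := by
    intro j i
    have h1 : I.p j ≤ (rounded ε I).p j := le_round_up _ _ hb (hp j)
    have h2 : (rounded ε I).s i ≤ I.s i := round_down_le _ _ hb (hs i).1
    have h3 : 0 < (rounded ε I).s i := by
      show 0 < (1 + ε) ^ ⌊Real.logb (1 + ε) (I.s i)⌋
      positivity
    exact div_le_div₀ ((hp j).le.trans h1) h1 h3 h2
  have hdate : ∀ k, I.u k ≤ (rounded ε I).u k := by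
    intro k
    have h0 : 0 < ε * pmin I := mul_pos hε hpm
    have h1 : I.u k + ε * pmin I ≤ (rounded ε I).u k :=
      le_round_up _ _ hb (by linarith [hu k])
    linarith
  have hload : ∀ i, load I σ t i ≤ load (rounded ε I) σ t i := fun i =>
    fold_max_mono _ _ _ fun j _ => by linarith [hproc j i]
  obtain ⟨ht, hov, hres⟩ := hfeas
  refine ⟨⟨ht, ?_, ?_⟩, hload, fold_max_mono _ _ _ fun i _ => hload i, ?_⟩
  · intro j j' hne hσ
    rcases hov j j' hne hσ with h | h
    · left; linarith [hproc j (σ j)]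
    · right; linarith [hproc j' (σ j')]
  · intro τ
    refine (hres τ).trans ?_
    refine Finset.sum_le_sum_of_subset_of_nonneg ?_ fun k _ _ => hq k
    intro k hk
    simp only [Finset.mem_filter, Finset.mem_univ, true_and] at hk ⊢
    exact (hdate k).trans_lt hk
  · refine Finset.sum_le_sum fun i _ => Real.rpow_le_rpow ?_ (hload i) (by linarith)
    unfold load
    rw [Finset.le_fold_max]
    exact Or.inl le_rfl
end

section
/- Let ε > 0, let I be an instance of the scheduling problem with a non-renewable resource, and let I' be its rounded instance. For every schedule (σ, t) that is feasible for I there exists a schedule (σ, t') for I' with the same machine assignment σ that is feasible for I' and in which, for every machine i, the load of i with respect to I' under (σ, t') is at most (1+ε)^3 times the load of i with respect to I under (σ, t). In particular, if (σ, t) has makespan C_max and norm-cost Φ with respect to I, then (σ, t') has makespan at most (1+ε)^3 · C_max and norm-cost at most (1+ε)^{3φ} · Φ with respect to I'. -/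
open Finset

lemma rnd_up_le (b x : ℝ) (hb : 1 < b) (hx : 0 < x) : b ^ ⌈Real.logb b x⌉ ≤ b * x := by
  have hb0 : 0 < b := by linarith
  have h1 : ((⌈Real.logb b x⌉ : ℤ) : ℝ) ≤ Real.logb b x + 1 := (Int.ceil_lt_add_one _).le
  rw [← Real.rpow_intCast]
  calc b ^ ((⌈Real.logb b x⌉ : ℤ) : ℝ) ≤ b ^ (Real.logb b x + 1) :=
        Real.rpow_le_rpow_of_exponent_le hb.le h1
    _ = b * x := by
        rw [Real.rpow_add hb0, Real.rpow_logb hb0 hb.ne' hx, Real.rpow_one, mul_comm]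

lemma le_rnd_down (b x : ℝ) (hb : 1 < b) (hx : 0 < x) : x ≤ b * b ^ ⌊Real.logb b x⌋ := by
  have hb0 : 0 < b := by linarith
  have h1 : Real.logb b x ≤ ((⌊Real.logb b x⌋ : ℤ) : ℝ) + 1 := (Int.lt_floor_add_one _).le
  rw [← Real.rpow_intCast]
  calc x = b ^ (Real.logb b x) := (Real.rpow_logb hb0 hb.ne' hx).symm
    _ ≤ b ^ (((⌊Real.logb b x⌋ : ℤ) : ℝ) + 1) := Real.rpow_le_rpow_of_exponent_le hb.le h1
    _ = _ := by rw [Real.rpow_add hb0, Real.rpow_one, mul_comm]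

lemma load_nonneg' {m n e : ℕ} (I : SchedInstance m n e) (σ : Fin n → Fin m)
    (t : Fin n → ℝ) (i : Fin m) : 0 ≤ load I σ t i :=
  (Finset.le_fold_max 0).2 (Or.inl le_rfl)

/-- For every schedule `(σ, t)` feasible for `I` there is a schedule `(σ, t')`,
with the same machine assignment, feasible for the rounded instance `I'`, in which the load
of every machine with respect to `I'` is at most `(1+ε)^3` times its load with respect to
`I`; in particular the makespan grows by at most a factor `(1+ε)^3` and the norm-cost by at
most a factor `(1+ε)^{3φ}`. -/
theorem rounded_feasible_of_feasible {m n e : ℕ} (ε : ℝ) (hε : 0 < ε) (hn : 0 < n)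
    (I : SchedInstance m n e) (hI : I.Valid) (φ : ℝ) (hφ : 1 < φ)
    (σ : Fin n → Fin m) (t : Fin n → ℝ)
    (hfeas : Feasible I σ t) :
    ∃ t' : Fin n → ℝ, Feasible (rounded ε I) σ t' ∧
      (∀ i, load (rounded ε I) σ t' i ≤ (1 + ε) ^ 3 * load I σ t i) ∧
      makespan (rounded ε I) σ t' ≤ (1 + ε) ^ 3 * makespan I σ t ∧
      normCost (rounded ε I) φ σ t' ≤ (1 + ε) ^ (3 * φ) * normCost I φ σ t := by
  obtain ⟨hs, -, hp, hd, hu, -, hq⟩ := hI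
  obtain ⟨ht, hov, hres⟩ := hfeas
  have hb : 1 < 1 + ε := by linarith
  have hb0 : 0 < 1 + ε := by linarith
  haveI : Nonempty (Fin n) := ⟨⟨0, hn⟩⟩
  have hpm : ∀ j, pmin I ≤ I.p j := fun j => ciInf_le (Set.finite_range _).bddBelow j
  have hpm0 : 0 < pmin I := by
    obtain ⟨j, hj⟩ := exists_eq_ciInf_of_finite (f := I.p)
    unfold pmin
    rw [← hj]
    exact hp j
  have hratio : ∀ j i, (rounded ε I).p j / (rounded ε I).s i
      ≤ (1 + ε) ^ 2 * (I.p j / I.s i) := by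
    intro j i
    have h1 : (rounded ε I).p j ≤ (1 + ε) * I.p j := rnd_up_le _ _ hb (hp j)
    have h2 : I.s i ≤ (1 + ε) * (rounded ε I).s i := le_rnd_down _ _ hb (hs i).1
    have h3 : 0 < (rounded ε I).s i := zpow_pos hb0 _
    have h4 := (hs i).1
    rw [← mul_div_assoc, div_le_div_iff₀ h3 h4]
    calc (rounded ε I).p j * I.s i ≤ ((1 + ε) * I.p j) * ((1 + ε) * (rounded ε I).s i) :=
          mul_le_mul h1 h2 h4.le (mul_pos hb0 (hp j)).le
      _ = _ := by ring
  have hloads : ∀ i, load (rounded ε I) σ (fun j => (1 + ε) ^ 2 * t j + (1 + ε) * (ε * pmin I)) i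
      ≤ (1 + ε) ^ 3 * load I σ t i := by
    intro i
    refine (Finset.fold_max_le _).2 ⟨mul_nonneg (by positivity) (load_nonneg' I σ t i), ?_⟩
    intro j hj
    have hL : t j + I.p j / I.s i ≤ load I σ t i :=
      (Finset.le_fold_max _).2 (Or.inr ⟨j, hj, le_rfl⟩)
    have h1 : I.p j ≤ I.p j / I.s i := le_div_self (hp j).le (hs i).1 (hs i).2
    have h2 : pmin I ≤ t j + I.p j / I.s i := by linarith [hpm j, ht j]
    have h3 := hratio j i
    have h4 : (1 + ε) * (ε * pmin I) ≤ (1 + ε) ^ 2 * (ε * (t j + I.p j / I.s i)) := by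
      have : (1 + ε) ≤ (1 + ε) ^ 2 := by nlinarith
      gcongr
    calc (1 + ε) ^ 2 * t j + (1 + ε) * (ε * pmin I) + (rounded ε I).p j / (rounded ε I).s i
        ≤ (1 + ε) ^ 3 * (t j + I.p j / I.s i) := by
          have : (1 + ε) ^ 3 * (t j + I.p j / I.s i) = (1 + ε) ^ 2 * t j
            + (1 + ε) ^ 2 * (ε * (t j + I.p j / I.s i)) + (1 + ε) ^ 2 * (I.p j / I.s i) := by ring
          linarith
      _ ≤ _ := by gcongr
  refine ⟨fun j => (1 + ε) ^ 2 * t j + (1 + ε) * (ε * pmin I), ⟨?_, ?_, ?_⟩, hloads, ?_, ?_⟩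
  · intro j
    have := ht j
    positivity
  · have key : ∀ j j', t j + I.p j / I.s (σ j) ≤ t j' →
        (1 + ε) ^ 2 * t j + (1 + ε) * (ε * pmin I)
          + (rounded ε I).p j / (rounded ε I).s (σ j)
          ≤ (1 + ε) ^ 2 * t j' + (1 + ε) * (ε * pmin I) := by
      intro j j' h
      have h1 := hratio j (σ j)
      have h2 := mul_le_mul_of_nonneg_left h (sq_nonneg (1 + ε))
      linarith
    intro j j' hne hσ
    exact (hov j j' hne hσ).imp (key j j') (key j' j)
  · intro τ
    have hb2 : 0 < (1 + ε) ^ 2 := by positivity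
    have hiff : ∀ x : ℝ, x < (τ - (1 + ε) * (ε * pmin I)) / (1 + ε) ^ 2 ↔
        (1 + ε) ^ 2 * x + (1 + ε) * (ε * pmin I) < τ := by
      intro x
      rw [lt_div_iff₀ hb2]
      constructor <;> intro h <;> linarith
    have h := hres ((τ - (1 + ε) * (ε * pmin I)) / (1 + ε) ^ 2)
    simp only [hiff] at h
    refine h.trans ?_
    refine Finset.sum_le_sum_of_subset_of_nonneg ?_ (fun k _ _ => hq k)
    intro k hk
    rw [Finset.mem_filter] at hk ⊢
    refine ⟨hk.1, lt_of_le_of_lt ?_ hk.2⟩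
    have hpos : 0 < I.u k + ε * pmin I := by
      have := hu k
      positivity
    have h1 : (rounded ε I).u k ≤ (1 + ε) * (I.u k + ε * pmin I) := rnd_up_le _ _ hb hpos
    have h2 : (1 + ε) * I.u k ≤ (1 + ε) ^ 2 * I.u k :=
      mul_le_mul_of_nonneg_right (by nlinarith) (hu k)
    linarith
  · have hM : 0 ≤ makespan I σ t := (Finset.le_fold_max 0).2 (Or.inl le_rfl)
    refine (Finset.fold_max_le _).2 ⟨by positivity, fun i hi => (hloads i).trans ?_⟩
    have : load I σ t i ≤ makespan I σ t := (Finset.le_fold_max _).2 (Or.inr ⟨i, hi, le_rfl⟩)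
    gcongr
  · unfold normCost
    rw [Finset.mul_sum]
    refine Finset.sum_le_sum fun i _ => ?_
    have h0 := load_nonneg' I σ t i
    calc _ ≤ ((1 + ε) ^ 3 * load I σ t i) ^ φ :=
          Real.rpow_le_rpow (load_nonneg' _ _ _ _) (hloads i) (by linarith)
      _ = _ := by
          rw [Real.mul_rpow (by positivity) h0, Real.rpow_mul hb0.le]
          norm_num
end

section
/- Let 0 < ε ≤ 1, φ > 1 and ψ ∈ [0,1], and consider an instance of the scheduling problem with a non-renewable resource in which machine 1 has speed 1 (the fastest speed). For every feasible schedule σ there exists a feasible schedule σ' with obj(σ') ≤ (1+ε)^φ · obj(σ) such that the makespan of σ' is attained on a machine of speed at least ε², i.e., there exists a machine i with s_i ≥ ε² whose load in σ' equals the maximum load over all machines in σ'. -/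
open Finset

theorem load_le_iff_aux {m n e : ℕ} (I : SchedInstance m n e) (σ : Fin n → Fin m)
    (t : Fin n → ℝ) (i : Fin m) (c : ℝ) :
    load I σ t i ≤ c ↔ 0 ≤ c ∧ ∀ j, σ j = i → t j + I.p j / I.s i ≤ c := by
  unfold load
  rw [Finset.fold_max_le]
  simp

theorem makespan_le_iff_aux {m n e : ℕ} (I : SchedInstance m n e) (σ : Fin n → Fin m)
    (t : Fin n → ℝ) (c : ℝ) :
    makespan I σ t ≤ c ↔ 0 ≤ c ∧ ∀ i, load I σ t i ≤ c := by
  unfold makespan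
  rw [Finset.fold_max_le]
  simp

/-- If machine `1` has speed `1`, then for every feasible schedule `σ` there is
a feasible schedule `σ'` whose objective value is at most `(1+ε)^φ` times that of `σ` and
whose makespan is attained on a machine of speed at least `ε²`. -/
theorem makespan_on_fast_machine {m n e : ℕ} (ε φ ψ : ℝ) (hε : 0 < ε) (hε1 : ε ≤ 1)
    (hφ : 1 < φ) (hψ : ψ ∈ Set.Icc (0 : ℝ) 1) (hm : 0 < m)
    (I : SchedInstance m n e) (hI : I.Valid) (hfast : I.s ⟨0, hm⟩ = 1)
    (σ : Fin n → Fin m) (t : Fin n → ℝ) (hfeas : Feasible I σ t) :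
    ∃ (σ' : Fin n → Fin m) (t' : Fin n → ℝ), Feasible I σ' t' ∧
      obj I φ ψ σ' t' ≤ (1 + ε) ^ φ * obj I φ ψ σ t ∧
      ∃ i, ε ^ 2 ≤ I.s i ∧ load I σ' t' i = makespan I σ' t' := by
  classical
  obtain ⟨hs, -, hp, hd, -, -, -⟩ := hI
  obtain ⟨ht0, hov, hres⟩ := hfeas
  obtain ⟨hψ0, hψ1⟩ := hψ
  have h0 : ∀ (σ : Fin n → Fin m) (t : Fin n → ℝ) i, 0 ≤ load I σ t i := fun σ t i =>
    ((load_le_iff_aux I σ t i _).1 le_rfl).1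
  have hlm : ∀ (σ : Fin n → Fin m) (t : Fin n → ℝ) i, load I σ t i ≤ makespan I σ t :=
    fun σ t i => ((makespan_le_iff_aux I σ t _).1 le_rfl).2 i
  have hjl : ∀ (σ : Fin n → Fin m) (t : Fin n → ℝ) j,
      t j + I.p j / I.s (σ j) ≤ load I σ t (σ j) :=
    fun σ t j => ((load_le_iff_aux I σ t _ _).1 le_rfl).2 j rfl
  have h1φ : 1 + ε ≤ (1 + ε) ^ φ := by
    have := Real.rpow_le_rpow_of_exponent_le (x := 1 + ε) (by linarith) hφ.le
    rwa [Real.rpow_one] at this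
  have hm0 : 0 ≤ makespan I σ t := ((makespan_le_iff_aux I σ t _).1 le_rfl).1
  have hn0 : 0 ≤ normCost I φ σ t := Finset.sum_nonneg fun i _ => Real.rpow_nonneg (h0 σ t i) _
  by_cases hcase : ∃ i, ε ^ 2 ≤ I.s i ∧ load I σ t i = makespan I σ t
  · refine ⟨σ, t, ⟨ht0, hov, hres⟩, ?_, hcase⟩
    have : 0 ≤ obj I φ ψ σ t :=
      add_nonneg (mul_nonneg hψ0 hm0) (mul_nonneg (by linarith) hn0)
    nlinarith
  set z : Fin m := ⟨0, hm⟩ with hz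
  have hε2 : ε ^ 2 ≤ ε := by nlinarith
  haveI : Nonempty (Fin m) := ⟨z⟩
  obtain ⟨i, hi⟩ := Finite.exists_max (load I σ t)
  have hiM : load I σ t i = makespan I σ t :=
    le_antisymm (hlm σ t i) ((makespan_le_iff_aux I σ t _).2 ⟨h0 σ t i, hi⟩)
  have hsi : I.s i < ε ^ 2 := by
    by_contra h
    exact hcase ⟨i, not_lt.1 h, hiM⟩
  have hiz : i ≠ z := by
    intro h
    rw [h, hfast] at hsi
    linarith
  set C := load I σ t i with hC
  have hspos := (hs i).1
  have hend : ∀ j, t j + I.p j / I.s (σ j) ≤ C := fun j => (hjl σ t j).trans (hi _)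
  have hdur : ∀ j, 0 < I.p j / I.s (σ j) := fun j => div_pos (hp j) (hs _).1
  have hCpos : 0 < C := by
    by_contra h
    refine hcase ⟨z, by rw [hfast]; linarith, ?_⟩
    rw [← hiM]
    linarith [hi z, h0 σ t z]
  obtain ⟨j0, hj0⟩ : ∃ j, σ j = i := by
    by_contra h
    push Not at h
    have : C ≤ 0 := (load_le_iff_aux I σ t i 0).2 ⟨le_rfl, fun j hj => absurd hj (h j)⟩
    linarith
  let σ' : Fin n → Fin m := fun j => if σ j = i then z else σ j
  let t' : Fin n → ℝ := fun j => if σ j = i then C + I.s i * t j else t j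
  have hσ1 : ∀ j, σ j = i → σ' j = z := fun j h => if_pos h
  have hσ2 : ∀ j, σ j ≠ i → σ' j = σ j := fun j h => if_neg h
  have ht1 : ∀ j, σ j = i → t' j = C + I.s i * t j := fun j h => if_pos h
  have ht2 : ∀ j, σ j ≠ i → t' j = t j := fun j h => if_neg h
  have hscale : ∀ a b c : ℝ, a + b / I.s i ≤ c → I.s i * a + b ≤ I.s i * c := by
    intro a b c h
    have h2 := mul_le_mul_of_nonneg_left h hspos.le
    rwa [mul_add, mul_div_cancel₀ _ hspos.ne'] at h2
  have htt : ∀ j, t j ≤ t' j := by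
    intro j
    by_cases h : σ j = i
    · rw [ht1 j h]
      have := mul_nonneg hspos.le (ht0 j)
      linarith [hend j, hdur j]
    · rw [ht2 j h]
  have hload : ∀ k, load I σ' t' k ≤ (1 + ε) * load I σ t (Equiv.swap z i k) := by
    intro k
    rw [load_le_iff_aux]
    refine ⟨mul_nonneg (by linarith) (h0 _ _ _), ?_⟩
    rintro j rfl
    by_cases h : σ j = i
    · rw [hσ1 j h, ht1 j h, Equiv.swap_apply_left, hfast, div_one, ← hC]
      have h3 := hend j
      rw [h] at h3
      have := hscale _ _ _ h3
      nlinarith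
    · rw [hσ2 j h, ht2 j h]
      by_cases h2 : σ j = z
      · rw [h2, Equiv.swap_apply_left, ← hC, ← h2]
        nlinarith [hend j]
      · rw [Equiv.swap_apply_of_ne_of_ne h2 h]
        nlinarith [hjl σ t j, h0 σ t (σ j)]
  have hCz : C ≤ load I σ' t' z := by
    have h3 := hjl σ' t' j0
    rw [hσ1 j0 hj0, ht1 j0 hj0, hfast, div_one] at h3
    have := mul_nonneg hspos.le (ht0 j0)
    linarith [hp j0]
  refine ⟨σ', t', ⟨fun j => (ht0 j).trans (htt j), ?_, ?_⟩, ?_, z, ?_, ?_⟩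
  · intro j j' hne hss
    by_cases h : σ j = i <;> by_cases h' : σ j' = i
    · rw [hσ1 j h, hσ1 j' h', ht1 j h, ht1 j' h', hfast, div_one, div_one]
      have h3 := hov j j' hne (h.trans h'.symm)
      rw [h, h'] at h3
      rcases h3 with h3 | h3
      · left; linarith [hscale _ _ _ h3]
      · right; linarith [hscale _ _ _ h3]
    · right
      rw [hσ2 j' h', ht2 j' h', ht1 j h]
      linarith [hend j', mul_nonneg hspos.le (ht0 j)]
    · left
      rw [hσ2 j h, ht2 j h, ht1 j' h']
      linarith [hend j, mul_nonneg hspos.le (ht0 j')]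
    · rw [hσ2 j h, hσ2 j' h'] at *
      rw [ht2 j h, ht2 j' h']
      exact hov j j' hne hss
  · intro τ
    refine le_trans (Finset.sum_le_sum_of_subset_of_nonneg ?_ fun j _ _ => hd j) (hres τ)
    intro j hj
    simp only [Finset.mem_filter, Finset.mem_univ, true_and] at hj ⊢
    exact (htt j).trans_lt hj
  · have hmk : makespan I σ' t' ≤ (1 + ε) ^ φ * makespan I σ t := by
      refine le_trans ?_ (mul_le_mul_of_nonneg_right h1φ hm0)
      rw [makespan_le_iff_aux]
      exact ⟨mul_nonneg (by linarith) hm0, fun k => (hload k).trans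
        (mul_le_mul_of_nonneg_left (hlm _ _ _) (by linarith))⟩
    have hnc : normCost I φ σ' t' ≤ (1 + ε) ^ φ * normCost I φ σ t := by
      unfold normCost
      rw [← Equiv.sum_comp (Equiv.swap z i) (fun k => load I σ t k ^ φ), Finset.mul_sum]
      refine Finset.sum_le_sum fun k _ => ?_
      rw [← Real.mul_rpow (by linarith) (h0 _ _ _)]
      exact Real.rpow_le_rpow (h0 _ _ _) (hload k) (by linarith)
    have a1 := mul_le_mul_of_nonneg_left hmk hψ0
    have a2 := mul_le_mul_of_nonneg_left hnc (sub_nonneg.2 hψ1)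
    unfold obj
    linarith
  · rw [hfast]; linarith
  · refine le_antisymm (hlm _ _ _) ((makespan_le_iff_aux _ _ _ _).2 ⟨h0 _ _ _, fun k => ?_⟩)
    rw [load_le_iff_aux]
    refine ⟨h0 _ _ _, ?_⟩
    rintro j rfl
    by_cases h : σ j = i
    · have := hjl σ' t' j
      rw [hσ1 j h] at this ⊢
      exact this
    · rw [hσ2 j h, ht2 j h]
      exact (hend j).trans hCz
end

section
/- Let ε > 0, φ > 1 and ψ ∈ [0,1]. For every feasible schedule (σ, t) of an instance of the scheduling problem with a non-renewable resource there exists a feasible schedule (σ, t̃) with the same machine assignment such that: (a) for every machine i, the load Λ̃_i of i under (σ, t̃) equals (1+ε) times the load Λ_i of i under (σ, t), and consequently obj of (σ, t̃) is at most (1+ε)^φ times obj of (σ, t); (b) every job j satisfies t̃(j) ≥ ε·Λ̃_{σ(j)}/(1+ε), so each machine i is active only within the time interval [ε·Λ̃_i/(1+ε), Λ̃_i]; and (c) if the makespan of (σ, t) is attained on a machine of speed at least ε², then the makespan of (σ, t̃) is attained on a machine of speed at least ε². -/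
open Finset

/-- Every feasible schedule `(σ, t)` can be transformed into a feasible schedule
`(σ, t̃)` with the same machine assignment such that (a) every machine's load is exactly
`(1+ε)` times its old load, hence the objective grows by at most a factor `(1+ε)^φ`;
(b) every job `j` starts at time at least `ε·Λ̃_{σ(j)}/(1+ε)`, so each machine is active only
within `[ε·Λ̃_i/(1+ε), Λ̃_i]`; and (c) if the makespan of `(σ, t)` is attained on a machine
of speed at least `ε²`, then so is the makespan of `(σ, t̃)`. -/
theorem time_stretching {m n e : ℕ} (ε φ ψ : ℝ) (hε : 0 < ε) (hφ : 1 < φ)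
    (hψ : ψ ∈ Set.Icc (0 : ℝ) 1)
    (I : SchedInstance m n e) (hI : I.Valid)
    (σ : Fin n → Fin m) (t : Fin n → ℝ) (hfeas : Feasible I σ t) :
    ∃ t' : Fin n → ℝ, Feasible I σ t' ∧
      (∀ i, load I σ t' i = (1 + ε) * load I σ t i) ∧
      obj I φ ψ σ t' ≤ (1 + ε) ^ φ * obj I φ ψ σ t ∧
      (∀ j, ε * load I σ t' (σ j) / (1 + ε) ≤ t' j) ∧
      ((∃ i, ε ^ 2 ≤ I.s i ∧ load I σ t i = makespan I σ t) →
        ∃ i, ε ^ 2 ≤ I.s i ∧ load I σ t' i = makespan I σ t') := by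
  obtain ⟨hs, -, hp, hd, hu, -, hq⟩ := hI
  obtain ⟨h0, hov, hres⟩ := hfeas
  have hL0 : ∀ i, 0 ≤ load I σ t i := fun i => by
    unfold load; exact (Finset.le_fold_max 0).2 (Or.inl le_rfl)
  have hLj : ∀ j, t j + I.p j / I.s (σ j) ≤ load I σ t (σ j) := fun j => by
    unfold load
    exact (Finset.le_fold_max _).2 (Or.inr ⟨j, by simp, le_rfl⟩)
  have hge : ∀ j, t j ≤ t j + ε * load I σ t (σ j) := fun j =>
    le_add_of_nonneg_right (mul_nonneg hε.le (hL0 _))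
  have hload : ∀ i, load I σ (fun j => t j + ε * load I σ t (σ j)) i
      = (1 + ε) * load I σ t i := by
    intro i
    apply le_antisymm
    · conv_lhs => unfold load
      refine (Finset.fold_max_le _).2 ⟨mul_nonneg (by linarith) (hL0 i), ?_⟩
      intro j hj
      have hji : σ j = i := (Finset.mem_filter.1 hj).2
      subst hji
      have := hLj j
      change t j + ε * load I σ t (σ j) + I.p j / I.s (σ j) ≤ (1 + ε) * load I σ t (σ j)
      linarith
    · by_cases hne : ∃ j, σ j = i ∧ load I σ t i ≤ t j + I.p j / I.s i
      · obtain ⟨j, rfl, hj⟩ := hne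
        conv_rhs => unfold load
        refine (Finset.le_fold_max _).2 (Or.inr ⟨j, by simp, ?_⟩)
        change (1 + ε) * load I σ t (σ j) ≤ t j + ε * load I σ t (σ j) + I.p j / I.s (σ j)
        linarith
      · have h1 : load I σ t i ≤ 0 := by
          have h2 : load I σ t i ≤ load I σ t i := le_rfl
          conv_rhs at h2 => unfold load
          rcases (Finset.le_fold_max _).1 h2 with h | ⟨j, hj, h⟩
          · exact h
          · exact absurd ⟨j, (Finset.mem_filter.1 hj).2, h⟩ hne
        have h3 : load I σ t i = 0 := le_antisymm h1 (hL0 i)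
        rw [h3, mul_zero]
        unfold load
        exact (Finset.le_fold_max 0).2 (Or.inl le_rfl)
  have hM0 : 0 ≤ makespan I σ t := by
    unfold makespan; exact (Finset.le_fold_max 0).2 (Or.inl le_rfl)
  have hM : makespan I σ (fun j => t j + ε * load I σ t (σ j))
      = (1 + ε) * makespan I σ t := by
    have h1 : (load I σ (fun j => t j + ε * load I σ t (σ j)))
      = fun i => (1 + ε) * load I σ t i := funext hload
    unfold makespan
    rw [h1]
    have := Finset.fold_hom (op := max) (op' := max) (s := (univ : Finset (Fin m)))
      (f := load I σ t) (b := (0 : ℝ)) (m := fun x : ℝ => (1 + ε) * x)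
      (fun x y => mul_max_of_nonneg x y (by linarith))
    simpa using this
  have hN : normCost I φ σ (fun j => t j + ε * load I σ t (σ j))
      = (1 + ε) ^ φ * normCost I φ σ t := by
    unfold normCost
    rw [Finset.mul_sum]
    refine Finset.sum_congr rfl fun i _ => ?_
    rw [hload, Real.mul_rpow (by linarith) (hL0 i)]
  refine ⟨fun j => t j + ε * load I σ t (σ j), ⟨?_, ?_, ?_⟩, hload, ?_, ?_, ?_⟩
  · exact fun j => (h0 j).trans (hge j)
  · intro j j' hne hσ
    have := hov j j' hne hσ
    simp only [hσ] at this ⊢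
    rcases this with h | h
    · left; linarith
    · right; linarith
  · intro τ
    refine le_trans (Finset.sum_le_sum_of_subset_of_nonneg ?_ fun j _ _ => hd j) (hres τ)
    intro j hj
    simp only [Finset.mem_filter, Finset.mem_univ, true_and] at hj ⊢
    exact (hge j).trans_lt hj
  · unfold obj
    rw [hM, hN]
    have h1 : (1 + ε) ≤ (1 + ε) ^ φ := Real.self_le_rpow_of_one_le (by linarith) hφ.le
    have h2 : (1 + ε) * (ψ * makespan I σ t) ≤ (1 + ε) ^ φ * (ψ * makespan I σ t) :=
      mul_le_mul_of_nonneg_right h1 (mul_nonneg hψ.1 hM0)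
    linarith
  · intro j
    rw [hload]
    have : ε * ((1 + ε) * load I σ t (σ j)) / (1 + ε) = ε * load I σ t (σ j) := by
      field_simp
    rw [this]
    have := h0 j
    simp only
    linarith
  · rintro ⟨i, hi, h⟩
    exact ⟨i, hi, by rw [hload, hM, h]⟩
end

section
/- Let 0 < ε ≤ 1, let n ≥ 1 be an integer, and let P be a finite set of positive reals with |P| ≤ n. Define G as the set of pairs (C, s) of positive reals such that s = (1+ε)^b for some integer b with ε² ≤ s ≤ 1, and C = (1+ε)^a for some integer a for which there exists p ∈ P with p/s ≤ C ≤ n·p/s. Then G is finite and its cardinality is at most n·(log_{1+ε} n + 2)·(1 − log_{1+ε} ε²). -/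
/-- The set of candidate guessed pairs `(C, s)`: `s` is an integer power of `1+ε` lying in
`[ε², 1]`, and `C` is an integer power of `1+ε` with `p/s ≤ C ≤ n·p/s` for some `p ∈ P`. -/
def guessSet (ε : ℝ) (n : ℕ) (P : Finset ℝ) : Set (ℝ × ℝ) :=
  {Cs | (∃ b : ℤ, Cs.2 = (1 + ε) ^ b) ∧ ε ^ 2 ≤ Cs.2 ∧ Cs.2 ≤ 1 ∧
    (∃ a : ℤ, Cs.1 = (1 + ε) ^ a) ∧
    ∃ p ∈ P, p / Cs.2 ≤ Cs.1 ∧ Cs.1 ≤ (n : ℝ) * (p / Cs.2)}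

/-- The set of guessed pairs `(C_opt, s_opt)` is finite and has at most
`n·(log_{1+ε} n + 2)·(1 − log_{1+ε} ε²)` elements. -/
theorem guessSet_card_bound (ε : ℝ) (hε : 0 < ε) (hε1 : ε ≤ 1) (n : ℕ) (hn : 1 ≤ n)
    (P : Finset ℝ) (hPpos : ∀ p ∈ P, (0 : ℝ) < p) (hPcard : P.card ≤ n) :
    (guessSet ε n P).Finite ∧
      ((guessSet ε n P).ncard : ℝ) ≤
        (n : ℝ) * (Real.logb (1 + ε) n + 2) * (1 - Real.logb (1 + ε) (ε ^ 2)) := by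
  have h1 : (1 : ℝ) < 1 + ε := by linarith
  have h0 : (0 : ℝ) < 1 + ε := by linarith
  have hn0 : (0 : ℝ) < n := by exact_mod_cast hn
  set L : ℝ := Real.logb (1 + ε) n with hL
  set M : ℝ := Real.logb (1 + ε) (ε ^ 2) with hM
  have hLnn : 0 ≤ L := Real.logb_nonneg h1 (by exact_mod_cast hn)
  have hMnp : M ≤ 0 := Real.logb_nonpos h1 (by positivity) (by nlinarith)
  let T : Finset (ℤ × ℤ) :=
    (P.biUnion fun p => Finset.Icc ⌈Real.logb (1 + ε) p⌉ ⌊L + Real.logb (1 + ε) p⌋) ×ˢ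
      Finset.Icc ⌈M⌉ 0
  let f : ℤ × ℤ → ℝ × ℝ := fun cb => ((1 + ε) ^ (cb.1 - cb.2), (1 + ε) ^ cb.2)
  have hlog : ∀ z : ℤ, Real.logb (1 + ε) ((1 + ε) ^ z) = z := by
    intro z
    rw [← Real.rpow_intCast, Real.logb_rpow h0 h1.ne']
  have hsub : guessSet ε n P ⊆ (T.image f : Finset (ℝ × ℝ)) := by
    rintro ⟨C, s⟩ ⟨⟨b, hb⟩, hs1, hs2, ⟨a, ha⟩, p, hp, hl, hu⟩
    simp only at hb hs1 hs2 ha hl hu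
    have hp0 := hPpos p hp
    have hs0 : 0 < s := by rw [hb]; positivity
    have hCs : C * s = (1 + ε) ^ (a + b) := by rw [ha, hb, zpow_add₀ h0.ne']
    have hl' : p ≤ (1 + ε) ^ (a + b) := by
      rw [← hCs]; exact (div_le_iff₀ hs0).1 hl
    have hu' : (1 + ε) ^ (a + b) ≤ n * p := by
      rw [← hCs]
      rw [← mul_div_assoc] at hu
      exact (le_div_iff₀ hs0).1 hu
    have e1 := Real.logb_le_logb_of_le h1 hp0 hl'
    have e2 := Real.logb_le_logb_of_le h1 (by positivity) hu'
    rw [hlog] at e1 e2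
    rw [Real.logb_mul hn0.ne' hp0.ne'] at e2
    have e3 := Real.logb_le_logb_of_le h1 (by positivity) hs1
    have e4 := Real.logb_le_logb_of_le h1 hs0 hs2
    rw [hb, hlog] at e3 e4
    rw [Real.logb_one] at e4
    rw [Finset.mem_coe, Finset.mem_image]
    refine ⟨(a + b, b), ?_, ?_⟩
    · simp only [T, Finset.mem_product, Finset.mem_biUnion, Finset.mem_Icc]
      exact ⟨⟨p, hp, Int.ceil_le.2 e1, Int.le_floor.2 e2⟩, Int.ceil_le.2 e3,
        by exact_mod_cast e4⟩
    · simp [f, ha, hb]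
  have hIcc : ∀ x K : ℝ, 0 ≤ K → ((Finset.Icc ⌈x⌉ ⌊K + x⌋).card : ℝ) ≤ K + 1 := by
    intro x K hK
    rw [Int.card_Icc]
    have h : (((⌊K + x⌋ + 1 - ⌈x⌉).toNat : ℤ) : ℝ) ≤ K + 1 := by
      rw [Int.toNat_eq_max, Int.cast_max]
      refine max_le ?_ (by push_cast; linarith)
      push_cast
      linarith [Int.floor_le (K + x), Int.le_ceil x]
    exact_mod_cast h
  refine ⟨(Finset.finite_toSet _).subset hsub, ?_⟩
  have hc : (guessSet ε n P).ncard ≤ T.card := by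
    refine (Set.ncard_le_ncard hsub (Finset.finite_toSet _)).trans ?_
    rw [Set.ncard_coe_finset]
    exact Finset.card_image_le
  have hA : ((P.biUnion fun p =>
      Finset.Icc ⌈Real.logb (1 + ε) p⌉ ⌊L + Real.logb (1 + ε) p⌋).card : ℝ) ≤ n * (L + 2) := by
    have := Finset.card_biUnion_le (s := P)
      (t := fun p => Finset.Icc ⌈Real.logb (1 + ε) p⌉ ⌊L + Real.logb (1 + ε) p⌋)
    calc _ ≤ ((∑ p ∈ P,
          (Finset.Icc ⌈Real.logb (1 + ε) p⌉ ⌊L + Real.logb (1 + ε) p⌋).card : ℕ) : ℝ) := by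
            exact_mod_cast this
      _ ≤ ∑ p ∈ P, (L + 2) := by
            rw [Nat.cast_sum]
            exact Finset.sum_le_sum fun p _ => (hIcc _ L hLnn).trans (by linarith)
      _ = P.card * (L + 2) := by rw [Finset.sum_const, nsmul_eq_mul]
      _ ≤ n * (L + 2) := by
            have : (P.card : ℝ) ≤ n := by exact_mod_cast hPcard
            gcongr
  have hB : ((Finset.Icc ⌈M⌉ 0).card : ℝ) ≤ 1 - M := by
    have := hIcc M (-M) (by linarith)
    simp only [neg_add_cancel, Int.floor_zero] at this
    linarith
  calc ((guessSet ε n P).ncard : ℝ) ≤ T.card := by exact_mod_cast hc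
    _ ≤ _ := by
      simp only [T]
      rw [Finset.card_product, Nat.cast_mul]
      exact mul_le_mul hA hB (by positivity) (by positivity)
end
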